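/- Let t be a semifinite template with m infinite clusters. The map w ↦ φ_{t,w} is injective: if w and w′ are two tuples of positive reals summing to 1 such that φ_{t,w}(λ) = φ_{t,w′}(λ) for all λ ∈ Z(t), then w = w′. -/

import Mathlib

/-!
Common definitions: the zigzag graph on binary words, templates and their coideals,
zigzag flanges and sections, the functions `F_λ(u)` and `φ_{t,w}`, and harmonic /
semifinite / indecomposable functions on subgraphs of the zigzag graph.
-/

open scoped ENNReal NNReal

namespace Zigzag

/-- Binary words: `true` is `+`, `false` is `−`. -/
abbrev BW := List Bool

/-- `CoveredBy a b`: `b` covers `a` in the subword order, i.e. `|b| = |a| + 1` and `a`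
is a subword of `b`; these are the edges of the zigzag graph. -/
def CoveredBy (a b : BW) : Prop := a.Sublist b ∧ b.length = a.length + 1

/-- The set of upper neighbours of `a` lying in `S` is finite. -/
lemma upSet_finite (S : Set BW) (a : BW) : {b | b ∈ S ∧ CoveredBy a b}.Finite :=
  (List.finite_length_eq Bool (a.length + 1)).subset (fun _ hb => hb.2.2)

/-- The finset of upper neighbours of `a` inside `S`. -/
noncomputable def upFinset (S : Set BW) (a : BW) : Finset BW :=
  (upSet_finite S a).toFinset

/-- A `[0,∞]`-valued function is harmonic on `S ⊆ Z` (with the edges induced from the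
zigzag graph) if its value at any vertex of `S` equals the sum of its values at the
upper neighbours lying in `S`. -/
def HarmonicOn (S : Set BW) (φ : BW → ℝ≥0∞) : Prop :=
  ∀ a ∈ S, φ a = ∑ b ∈ upFinset S a, φ b

/-- A template: a nonempty sequence of clusters with alternating signs, each cluster
being a sign (`true` = `+`, `false` = `−`) with a multiplicity in `{1,2,…} ∪ {∞}`,
containing at least one infinite cluster. -/
structure Template where
  clusters : List (Bool × ℕ∞)
  ne : clusters ≠ []
  pos : ∀ c ∈ clusters, c.2 ≠ 0
  alternating : clusters.Chain' fun c d => c.1 ≠ d.1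
  hasInf : ∃ c ∈ clusters, c.2 = ⊤

/-- The binary word obtained from a list of clusters by replacing every infinite
multiplicity by `N` (and keeping the finite multiplicities). -/
def clWord (cs : List (Bool × ℕ∞)) (N : ℕ) : BW :=
  (cs.map fun c => List.replicate (if c.2 = ⊤ then N else c.2.toNat) c.1).flatten

/-- The coideal generated by a list of clusters: all binary words that are subwords of
some instantiation. -/
def Zcl (cs : List (Bool × ℕ∞)) : Set BW := {a | ∃ N, a.Sublist (clWord cs N)}

/-- The coideal `Z(t)` of the zigzag graph attached to a template `t`. -/
def Zt (t : Template) : Set BW := Zcl t.clusters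

/-- The cluster in position `i` of `t` is a separating cluster: a one-symbol finite
cluster which is not outermost and whose two neighbours are infinite clusters
(necessarily of the same sign). -/
def Template.isSep (t : Template) (i : ℕ) : Prop :=
  0 < i ∧ i + 1 < t.clusters.length ∧
  (t.clusters.getD i (true, 1)).2 = 1 ∧
  (t.clusters.getD (i - 1) (true, 1)).2 = ⊤ ∧
  (t.clusters.getD (i + 1) (true, 1)).2 = ⊤

/-- A template is finite if all its finite clusters are separating; otherwise it is
semifinite. -/
def Template.IsFiniteTemplate (t : Template) : Prop :=
  ∀ i < t.clusters.length, (t.clusters.getD i (true, 1)).2 ≠ ⊤ → t.isSep i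

/-- The number of infinite clusters of a template. -/
def Template.numInf (t : Template) : ℕ :=
  (t.clusters.filter fun c => decide (c.2 = ⊤)).length

/-- Position `p` of `t` carries a finite non-separating cluster, i.e. a cluster
contributing to the zigzag flange of `t`. -/
def IsFlangePos (t : Template) (p : ℕ) : Prop :=
  p < t.clusters.length ∧ (t.clusters.getD p (true, 1)).2 ≠ ⊤ ∧ ¬t.isSep p

/-- Decrease by one the multiplicity of the cluster in position `p`. -/
def decAt (cs : List (Bool × ℕ∞)) (p : ℕ) : List (Bool × ℕ∞) :=
  cs.set p ((cs.getD p (true, 1)).1, (cs.getD p (true, 1)).2 - 1)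

/-- The coideal `J(t)`: the union of the coideals `Z(r)` over all `r` obtained from `t`
by removing a single symbol from a cluster corresponding to a block of a binary word
from the zigzag flange of `t` (no merging of clusters is needed to generate `Z(r)`). -/
def Jt (t : Template) : Set BW :=
  {a | ∃ p, IsFlangePos t p ∧ a ∈ Zcl (decAt t.clusters p)}

/-- The canonical splitting of a template `t` into its zigzag flange
`fl(t) = (a₀, …, a_k)` (given by the lists `A 0, …, A k` of clusters, each consisting
of finite non-separating clusters of `t`) and its sections `t₁, …, t_k` (the maximal
groups of consecutive clusters forming finite templates), so that
`t = (a₀, t₁, a₁, …, a_{k−1}, t_k, a_k)`.  The two `interior` conditions express the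
maximality of the decomposition. -/
structure SectionData (t : Template) where
  k : ℕ
  A : Fin (k + 1) → List (Bool × ℕ∞)
  T : Fin k → Template
  concat : t.clusters
      = A 0 ++ (List.ofFn fun i : Fin k => (T i).clusters ++ A i.succ).flatten
  finA : ∀ j, ∀ c ∈ A j, c.2 ≠ ⊤
  secFin : ∀ i, (T i).IsFiniteTemplate
  interior_ne : ∀ j : Fin (k + 1), (j : ℕ) ≠ 0 → (j : ℕ) ≠ k → A j ≠ []
  interior_not_sep : ∀ j : Fin (k + 1), (j : ℕ) ≠ 0 → (j : ℕ) ≠ k →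
      ∀ s : Bool, A j ≠ [(s, 1)]

/-- The binary word corresponding to a list of finite clusters (a flange word). -/
def flangeWord (cs : List (Bool × ℕ∞)) : BW :=
  (cs.map fun c => List.replicate c.2.toNat c.1).flatten

/-- `a₀ ⊔ ℓ 1 ⊔ a₁ ⊔ … ⊔ ℓ k ⊔ a_k` (empty flange words disappear). -/
def assemble {t : Template} (D : SectionData t) (ℓ : Fin D.k → BW) : BW :=
  flangeWord (D.A 0) ++ (List.ofFn fun i : Fin D.k => ℓ i ++ flangeWord (D.A i.succ)).flatten

/-- `ℓ` is a decomposition of `a` along the sections of `t`: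
`bw(a) = a₀ ⊔ bw(ℓ 1) ⊔ a₁ ⊔ … ⊔ bw(ℓ k) ⊔ a_k` with `ℓ i ∈ Z(tᵢ)`. -/
def decompOf {t : Template} (D : SectionData t) (a : BW) (ℓ : Fin D.k → BW) : Prop :=
  (∀ i, ℓ i ∈ Zt (D.T i)) ∧ a = assemble D ℓ

/-- The signs of the infinite clusters of a list of clusters, in order. -/
def infSigns (cs : List (Bool × ℕ∞)) : List Bool :=
  (cs.filter fun c => decide (c.2 = ⊤)).map Prod.fst

/-- The number of weights consumed by the sections preceding the `i`-th one. -/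
def secOffset {t : Template} (D : SectionData t) (i : Fin D.k) : ℕ :=
  ∑ i' ∈ Finset.univ.filter (· < i), (infSigns (D.T i').clusters).length

/-- The part `vᵢ` of the tuple of weights `w` corresponding to the infinite clusters of
the `i`-th section, as a sequence of (sign, weight) pairs. -/
def vD {t : Template} (D : SectionData t) (w : List ℝ) (i : Fin D.k) : List (Bool × ℝ) :=
  (infSigns (D.T i).clusters).zip (w.drop (secOffset D i))

/-- `F_λ(u)` for a finite sequence `u` of (sign, length) pairs and a zigzag `λ`
(encoded by its binary word `a`, so that `λ` has `a.length + 1` boxes): the sum, over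
all decompositions of `λ` into `u.length` consecutive (possibly empty) zigzags
`λ(1), …, λ(m)` with `λ(i)` a row when the `i`-th sign is `+` and a column when it is
`−`, of `u₁ ^ |λ(1)| ⋯ u_m ^ |λ(m)|`.  A decomposition is recorded by the tuple `c` of
the numbers of boxes of the pieces; the row/column constraint says that the letters of
`a` strictly inside the `i`-th group of boxes all equal the `i`-th sign. -/
noncomputable def Fword (u : List (Bool × ℝ)) (a : BW) : ℝ :=
  ∑ c ∈ (Finset.Nat.antidiagonalTuple u.length (a.length + 1)).filter
      (fun c => ∀ i : Fin u.length,
        (a.drop (∑ i' ∈ Finset.univ.filter (· < i), c i')).take (c i - 1)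
          = List.replicate (c i - 1) (u.get i).1),
    ∏ i, (u.get i).2 ^ c i

open Classical in
/-- The function `φ_{t,w}` attached to a semifinite zigzag growth model `(t, w)`:
it equals `+∞` on `J(t)`, and on `Z(t) ∖ J(t)` it equals
`F_{λ^{(1)}}(v₁) ⋯ F_{λ^{(k)}}(v_k)`, where `(λ^{(1)}, …, λ^{(k)})` is the (unique)
decomposition of `λ` along the sections of `t` (it is `0` off `Z(t)`). -/
noncomputable def phiTW (t : Template) (D : SectionData t) (w : List ℝ) (a : BW) : ℝ≥0∞ :=
  if a ∉ Zt t then 0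
  else if a ∈ Jt t then ⊤
  else if h : ∃ ℓ : Fin D.k → BW, decompOf D a ℓ then
    ENNReal.ofReal (∏ i, Fword (vD D w i) (h.choose i))
  else 0

section Kcone

/-- The relation `λ = ∑_{μ : λ ↗ μ} μ` (within `S`) as an element of the free module. -/
noncomputable def relOf (S : Set BW) (a : BW) : BW →₀ ℝ :=
  Finsupp.single a 1 - ∑ b ∈ upFinset S a, Finsupp.single b 1

/-- The submodule of relations defining `K(S)`. -/
noncomputable def Krel (S : Set BW) : Submodule ℝ (BW →₀ ℝ) :=
  Submodule.span ℝ {f | ∃ a ∈ S, f = relOf S a}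

/-- The class of `f` in `K(S) = (⊕_{λ ∈ S} ℝ λ) ⧸ (relations)`. -/
noncomputable def kmk (S : Set BW) (f : BW →₀ ℝ) : (BW →₀ ℝ) ⧸ Krel S :=
  Submodule.Quotient.mk f

/-- Nonnegative formal combinations of vertices of `S`. -/
def NonnegOn (S : Set BW) (f : BW →₀ ℝ) : Prop :=
  (∀ x, 0 ≤ f x) ∧ ∀ x ∈ f.support, x ∈ S

/-- The cone `K⁺(S)` spanned by the vertices of `S` in `K(S)`. -/
noncomputable def Kpos (S : Set BW) : Set ((BW →₀ ℝ) ⧸ Krel S) :=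
  kmk S '' {f | NonnegOn S f}

/-- The order defined by the cone `K⁺(S)`: `x ≤_K y` iff `y − x ∈ K⁺(S)`. -/
def leK (S : Set BW) (x y : (BW →₀ ℝ) ⧸ Krel S) : Prop := y - x ∈ Kpos S

/-- The value of (the canonical extension of) `φ` at a nonnegative combination of
vertices. -/
noncomputable def phiHat (φ : BW → ℝ≥0∞) (f : BW →₀ ℝ) : ℝ≥0∞ :=
  ∑ x ∈ f.support, ENNReal.ofReal (f x) * φ x

/-- `φ` is finite on `S`. -/
def FiniteOn (S : Set BW) (φ : BW → ℝ≥0∞) : Prop := ∀ a ∈ S, φ a ≠ ⊤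

/-- `φ` is a semifinite function on (the graph) `S`: it is not everywhere finite, and
its value at any element `a` of the cone `K⁺` is the supremum of its values at the
elements `b ≤_K a` of the cone where it is finite. -/
def SemifiniteOn (S : Set BW) (φ : BW → ℝ≥0∞) : Prop :=
  (∃ a ∈ S, φ a = ⊤) ∧
  ∀ f : BW →₀ ℝ, NonnegOn S f →
    phiHat φ f =
      ⨆ g ∈ {g : BW →₀ ℝ |
        NonnegOn S g ∧ leK S (kmk S g) (kmk S f) ∧ phiHat φ g ≠ ⊤}, phiHat φ g

/-- A semifinite harmonic function `φ` on `S` is indecomposable if any finite or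
semifinite harmonic function `φ′ ≤ φ` on `S` which does not vanish identically on the
finiteness ideal of `φ` is a constant multiple of `φ` on that ideal. -/
def IndecSemifiniteOn (S : Set BW) (φ : BW → ℝ≥0∞) : Prop :=
  ∀ φ' : BW → ℝ≥0∞, HarmonicOn S φ' →
    (FiniteOn S φ' ∨ SemifiniteOn S φ') →
    (∀ a ∈ S, φ' a ≤ φ a) →
    (∃ a ∈ S, φ a ≠ ⊤ ∧ φ' a ≠ 0) →
    ∃ c : ℝ≥0, ∀ a ∈ S, φ a ≠ ⊤ → φ' a = (c : ℝ≥0∞) * φ a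

end Kcone

end Zigzag

namespace Zigzag

/-- `F` with the number of boxes as an independent argument. -/
noncomputable def Fboxes (u : List (Bool × ℝ)) (a : BW) (n : ℕ) : ℝ :=
  ∑ c ∈ Finset.Nat.antidiagonalTuple u.length n,
    if ∀ i : Fin u.length,
        (a.drop (∑ i' ∈ Finset.univ.filter (· < i), c i')).take (c i - 1)
          = List.replicate (c i - 1) (u.get i).1
    then ∏ i, (u.get i).2 ^ c i else 0

lemma Fword_eq_Fboxes (u : List (Bool × ℝ)) (a : BW) :
    Fword u a = Fboxes u a (a.length + 1) :=
  Finset.sum_filter _ _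

lemma sum_antidiagonalTuple_succ {M : Type*} [AddCommMonoid M] (k n : ℕ)
    (f : (Fin (k + 1) → ℕ) → M) :
    ∑ c ∈ Finset.Nat.antidiagonalTuple (k + 1) n, f c
      = ∑ p ∈ Finset.HasAntidiagonal.antidiagonal n, ∑ c ∈ Finset.Nat.antidiagonalTuple k p.2,
          f (Fin.cons p.1 c) := by
  rw [Finset.sum_sigma']
  refine Finset.sum_bij' (fun c _ => ⟨(c 0, ∑ i, Fin.tail c i), Fin.tail c⟩)
    (fun p _ => Fin.cons p.1.1 p.2) ?_ ?_ ?_ ?_ ?_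
  · intro c hc
    rw [Finset.Nat.mem_antidiagonalTuple, Fin.sum_univ_succ] at hc
    simp [Finset.Nat.mem_antidiagonalTuple, Fin.tail, hc]
  · rintro ⟨⟨x, y⟩, c⟩ hp
    simp only [Finset.mem_sigma, Finset.HasAntidiagonal.mem_antidiagonal,
      Finset.Nat.mem_antidiagonalTuple] at hp
    simp [Finset.Nat.mem_antidiagonalTuple, Fin.sum_univ_succ, hp.1, hp.2]
  · intro c _
    simp
  · rintro ⟨⟨x, y⟩, c⟩ hp
    simp only [Finset.mem_sigma, Finset.HasAntidiagonal.mem_antidiagonal,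
      Finset.Nat.mem_antidiagonalTuple] at hp
    simp [hp.2]
  · intro c _
    simp

lemma sum_lt_cons_succ {k : ℕ} (x : ℕ) (c : Fin k → ℕ) (i : Fin k) :
    ∑ i' ∈ Finset.univ.filter (· < i.succ), (Fin.cons x c : Fin (k + 1) → ℕ) i'
      = x + ∑ i' ∈ Finset.univ.filter (· < i), c i' := by
  rw [Finset.sum_filter, Fin.sum_univ_succ, Finset.sum_filter]
  simp [Fin.succ_lt_succ_iff]

lemma Fboxes_cons (v : Bool × ℝ) (u : List (Bool × ℝ)) (a : BW) (n : ℕ) :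
    Fboxes (v :: u) a n = ∑ p ∈ Finset.HasAntidiagonal.antidiagonal n,
      if a.take (p.1 - 1) = List.replicate (p.1 - 1) v.1
      then v.2 ^ p.1 * Fboxes u (a.drop p.1) p.2 else 0 := by
  unfold Fboxes
  erw [sum_antidiagonalTuple_succ]
  refine Finset.sum_congr rfl fun p _ => ?_
  split_ifs with h
  · rw [Finset.mul_sum]
    refine Finset.sum_congr rfl fun c _ => ?_
    rw [mul_ite, mul_zero]
    refine if_congr ?_ ?_ rfl
    · refine (Fin.forall_fin_succ (n := u.length)).trans ?_
      have h0 : (List.take (Fin.cons (α := fun _ => ℕ) p.1 c 0 - 1) (List.drop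
          (∑ i' ∈ Finset.univ.filter (· < (0 : Fin (u.length + 1))),
            Fin.cons (α := fun _ => ℕ) p.1 c i') a))
          = List.replicate (Fin.cons (α := fun _ => ℕ) p.1 c 0 - 1) v.1 := by
        simpa using h
      refine (and_iff_right h0).trans (forall_congr' fun i => ?_)
      erw [sum_lt_cons_succ, ← List.drop_drop]
      rfl
    · refine (Fin.prod_univ_succ (n := u.length) _).trans ?_
      simp
  · refine Finset.sum_eq_zero fun c _ => if_neg fun hc => h ?_
    simpa using hc 0

lemma Fboxes_zero (u : List (Bool × ℝ)) (a : BW) : Fboxes u a 0 = 1 := by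
  simp [Fboxes, Finset.Nat.antidiagonalTuple_zero_right]

lemma Fword_nil (a : BW) : Fword [] a = 0 := by
  simp [Fword]

lemma Fword_cons (v : Bool × ℝ) (u : List (Bool × ℝ)) (a : BW) :
    Fword (v :: u) a = ∑ c ∈ Finset.range (a.length + 2),
      if a.take (c - 1) = List.replicate (c - 1) v.1
      then v.2 ^ c * Fboxes u (a.drop c) (a.length + 1 - c) else 0 := by
  rw [Fword_eq_Fboxes, Fboxes_cons, Finset.Nat.sum_antidiagonal_eq_sum_range_succ_mk]

lemma Fword_cons_nil (v : Bool × ℝ) (u : List (Bool × ℝ)) :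
    Fword (v :: u) [] = Fword u [] + v.2 := by
  rw [Fword_cons]
  simp [Finset.sum_range_succ, Fword_eq_Fboxes, Fboxes_zero]

lemma Fword_cons_ne (v : Bool × ℝ) (u : List (Bool × ℝ)) {b : Bool} (hb : b ≠ v.1) (a : BW) :
    Fword (v :: u) (b :: a) = Fword u (b :: a) + v.2 * Fword u a := by
  rw [Fword_cons, Finset.sum_range_succ', Finset.sum_range_succ', Finset.sum_eq_zero]
  · simp [Fword_eq_Fboxes, add_comm]
  · intro c _
    simp [List.replicate_succ, hb]

lemma Fword_cons_self (v : Bool × ℝ) (u : List (Bool × ℝ)) (a : BW) :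
    Fword (v :: u) (v.1 :: a) = Fword u (v.1 :: a) + v.2 * Fword (v :: u) a := by
  rw [Fword_cons, Finset.sum_range_succ', Fword_cons v u a, Finset.mul_sum, add_comm]
  congr 1
  · simp [Fword_eq_Fboxes]
  · refine Finset.sum_congr rfl fun c _ => ?_
    rw [mul_ite, mul_zero]
    refine if_congr ?_ ?_ rfl
    · cases c <;> simp [List.replicate_succ]
    · rw [pow_succ']
      simp [mul_assoc, Nat.add_sub_add_right]

lemma Fword_nonneg {u : List (Bool × ℝ)} (hu : ∀ v ∈ u, 0 < v.2) (a : BW) : 0 ≤ Fword u a :=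
  Finset.sum_nonneg fun _ _ => Finset.prod_nonneg fun _ _ =>
    pow_nonneg (hu _ (List.get_mem _ _)).le _

lemma Fword_cons_cons (v : Bool × ℝ) (u : List (Bool × ℝ)) (b : Bool) (a : BW) :
    Fword (v :: u) (b :: a) = Fword u (b :: a)
      + v.2 * if b = v.1 then Fword (v :: u) a else Fword u a := by
  split_ifs with h
  · subst h; exact Fword_cons_self v u a
  · exact Fword_cons_ne v u h a

/-- Enlarging a word preserves the vanishing of `F`. -/
lemma Fword_cons_word_eq_zero {u : List (Bool × ℝ)} (hu : ∀ v ∈ u, 0 < v.2) {a : BW}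
    (h : Fword u a = 0) (b : Bool) : Fword u (b :: a) = 0 := by
  induction u with
  | nil => exact Fword_nil _
  | cons v u ih =>
    have hu' : ∀ v ∈ u, 0 < v.2 := fun x hx => hu x (List.mem_cons_of_mem _ hx)
    have h0 : Fword u a = 0 := by
      have hn := Fword_nonneg hu' a
      have hv := hu v List.mem_cons_self
      cases a with
      | nil => rw [Fword_cons_nil] at h; linarith
      | cons c a =>
        rw [Fword_cons_cons] at h
        have : 0 ≤ v.2 * if c = v.1 then Fword (v :: u) a else Fword u a := by
          refine mul_nonneg hv.le ?_
          split_ifs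
          exacts [Fword_nonneg hu a, Fword_nonneg hu' a]
        linarith
    rw [Fword_cons_cons, ih hu' h0, h, h0]
    simp

lemma Fword_append_word_eq_zero {u : List (Bool × ℝ)} (hu : ∀ v ∈ u, 0 < v.2) {a : BW}
    (h : Fword u a = 0) (p : BW) : Fword u (p ++ a) = 0 := by
  induction p with
  | nil => exact h
  | cons b p ih => exact Fword_cons_word_eq_zero hu ih b

/-- The inductive description of the cluster lists of finite templates. -/
inductive IsSection : List (Bool × ℕ∞) → Prop
  | single (s : Bool) : IsSection [(s, ⊤)]
  | adj {s s' : Bool} {r : List (Bool × ℕ∞)} (h : s ≠ s') (hr : IsSection ((s', ⊤) :: r)) :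
      IsSection ((s, ⊤) :: (s', ⊤) :: r)
  | sep {s b : Bool} {r : List (Bool × ℕ∞)} (h : s ≠ b) (hr : IsSection ((s, ⊤) :: r)) :
      IsSection ((s, ⊤) :: (b, 1) :: (s, ⊤) :: r)

lemma isSection_of_forall_sep (cs : List (Bool × ℕ∞)) (hne : cs ≠ [])
    (halt : cs.IsChain fun c d => c.1 ≠ d.1)
    (hsep : ∀ i < cs.length, (cs.getD i (true, 1)).2 ≠ ⊤ →
      0 < i ∧ i + 1 < cs.length ∧ (cs.getD i (true, 1)).2 = 1 ∧
      (cs.getD (i - 1) (true, 1)).2 = ⊤ ∧ (cs.getD (i + 1) (true, 1)).2 = ⊤) :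
    IsSection cs := by
  induction hN : cs.length using Nat.strong_induction_on generalizing cs with
  | _ N ih =>
  match cs, hne, halt, hsep with
  | (s, m) :: cs, _, halt, hsep =>
    have hm : m = ⊤ := by
      by_contra hm
      simpa using (hsep 0 (by simp) (by simpa using hm)).1
    subst hm
    match cs, halt, hsep with
    | [], _, _ => exact .single s
    | (s', m') :: r, halt, hsep =>
      rw [List.isChain_cons_cons] at halt
      by_cases hm' : m' = ⊤
      · subst hm'
        refine .adj halt.1 (ih _ (by simp [← hN]) _ (by simp) halt.2 (fun i hi hi' => ?_) rfl)
        obtain ⟨-, h2, h3, h4, h5⟩ := hsep (i + 1) (by simpa using hi) (by simpa using hi')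
        rcases i with _ | i
        · simp at hi'
        · exact ⟨by simp, by simpa using h2, by simpa using h3, by simpa using h4,
            by simpa using h5⟩
      · obtain ⟨-, h2, h3, h4, h5⟩ := hsep 1 (by simp) (by simpa using hm')
        match r, halt, hsep, h2, h5 with
        | (s'', m'') :: r, halt, hsep, h2, h5 =>
          obtain rfl : m' = 1 := by simpa using h3
          obtain rfl : m'' = ⊤ := by simpa using h5
          rw [List.isChain_cons_cons] at halt
          obtain rfl : s'' = s := by
            have h1 := halt.1
            have h2 := halt.2.1
            revert h1 h2
            cases s <;> cases s' <;> cases s'' <;> simp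
          refine .sep halt.1 (ih _ (by simp [← hN]) _ (by simp) halt.2.2 (fun i hi hi' => ?_) rfl)
          obtain ⟨-, h2, h3, h4, h5⟩ := hsep (i + 2) (by simpa using hi) (by simpa using hi')
          rcases i with _ | i
          · simp at hi'
          · exact ⟨by simp, by simp at h2 ⊢; omega, by simpa using h3, by simpa using h4,
              by simpa using h5⟩

lemma Template.isSection {t : Template} (ht : t.IsFiniteTemplate) : IsSection t.clusters :=
  isSection_of_forall_sep _ t.ne t.alternating ht

/-- The instantiation of a list of clusters in which the `j`-th infinite cluster receives
multiplicity `n j`. -/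
def instWord : List (Bool × ℕ∞) → (ℕ → ℕ) → BW
  | [], _ => []
  | c :: cs, n =>
    if c.2 = ⊤ then List.replicate (n 0) c.1 ++ instWord cs (fun j => n (j + 1))
    else List.replicate c.2.toNat c.1 ++ instWord cs n

lemma instWord_cons_top (s : Bool) (cs : List (Bool × ℕ∞)) (n : ℕ → ℕ) :
    instWord ((s, ⊤) :: cs) n = List.replicate (n 0) s ++ instWord cs (fun j => n (j + 1)) := by
  simp [instWord]

lemma instWord_cons_one (s : Bool) (cs : List (Bool × ℕ∞)) (n : ℕ → ℕ) :
    instWord ((s, 1) :: cs) n = s :: instWord cs n := by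
  simp [instWord]

lemma infSigns_cons_top (s : Bool) (cs : List (Bool × ℕ∞)) :
    infSigns ((s, ⊤) :: cs) = s :: infSigns cs := by
  simp [infSigns]

lemma infSigns_cons_one (s : Bool) (cs : List (Bool × ℕ∞)) :
    infSigns ((s, 1) :: cs) = infSigns cs := by
  simp [infSigns]

lemma zip_pos {xs : List ℝ} (hx : ∀ x ∈ xs, 0 < x) (ss : List Bool) :
    ∀ v ∈ ss.zip xs, 0 < v.2 :=
  fun v hv => hx _ (List.of_mem_zip (a := v.1) (b := v.2) hv).2

lemma replicate_append_eq_cons {n : ℕ} (hn : 1 ≤ n) (s : Bool) (a : BW) :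
    List.replicate n s ++ a = s :: (List.replicate (n - 1) s ++ a) := by
  obtain ⟨n, rfl⟩ := Nat.exists_eq_add_of_le' hn
  simp [List.replicate_succ]

lemma replicate_append_eq_append {n : ℕ} (hn : 1 ≤ n) (s : Bool) (a : BW) :
    List.replicate n s ++ a = List.replicate (n - 1) s ++ s :: a := by
  obtain ⟨n, rfl⟩ := Nat.exists_eq_add_of_le' hn
  simp [List.replicate_succ']

lemma Fword_zip_cons_ne {s b : Bool} (h : b ≠ s) (ss : List Bool) (x : ℝ) (xs : List ℝ)
    (a : BW) :
    Fword ((s :: ss).zip (x :: xs)) (b :: a)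
      = Fword (ss.zip xs) (b :: a) + x * Fword (ss.zip xs) a :=
  Fword_cons_ne (s, x) (ss.zip xs) h a

lemma Fword_zip_cons_self (s : Bool) (ss : List Bool) (x : ℝ) (xs : List ℝ) (a : BW) :
    Fword ((s :: ss).zip (x :: xs)) (s :: a)
      = Fword (ss.zip xs) (s :: a) + x * Fword ((s :: ss).zip (x :: xs)) a :=
  Fword_cons_self (s, x) (ss.zip xs) a

/-- A full instantiation of a section cannot be covered without the first infinite cluster. -/
lemma Fword_tail_instWord {cs : List (Bool × ℕ∞)} (hcs : IsSection cs) (xs : List ℝ)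
    (hx : ∀ x ∈ xs, 0 < x) (n : ℕ → ℕ) (hn : ∀ j, 1 ≤ n j) :
    Fword ((infSigns cs).tail.zip xs) (instWord cs n) = 0 := by
  induction hcs generalizing xs n with
  | single s => simp [infSigns, Fword_nil]
  | @adj s s' r h hr ih =>
    cases xs with
    | nil => simp [Fword_nil]
    | cons x xs =>
      have ih := ih xs (fun y hy => hx y (List.mem_cons_of_mem _ hy)) (fun j => n (j + 1))
        (fun j => hn _)
      rw [instWord_cons_top, replicate_append_eq_append (hn 0)]
      refine Fword_append_word_eq_zero (zip_pos hx _) ?_ _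
      rw [infSigns_cons_top s, infSigns_cons_top s'] at *
      simp only [List.tail_cons] at *
      rw [Fword_zip_cons_ne h, ih, Fword_cons_word_eq_zero (zip_pos (by simp_all) _) ih]
      simp
  | @sep s b r h hr ih =>
    cases xs with
    | nil => simp [Fword_nil]
    | cons x xs =>
      have ih := ih xs (fun y hy => hx y (List.mem_cons_of_mem _ hy)) (fun j => n (j + 1))
        (fun j => hn _)
      rw [instWord_cons_top, instWord_cons_one]
      refine Fword_append_word_eq_zero (zip_pos hx _) ?_ _
      rw [infSigns_cons_top s, infSigns_cons_one, infSigns_cons_top s] at *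
      simp only [List.tail_cons] at *
      rw [Fword_zip_cons_ne h.symm, ih, Fword_cons_word_eq_zero (zip_pos (by simp_all) _) ih]
      simp

lemma Fword_replicate_append (s : Bool) (ss : List Bool) (x : ℝ) (xs : List ℝ) (a : BW) (n : ℕ)
    (h : ∀ k < n, Fword (ss.zip xs) (List.replicate (k + 1) s ++ a) = 0) :
    Fword ((s :: ss).zip (x :: xs)) (List.replicate n s ++ a)
      = x ^ n * Fword ((s :: ss).zip (x :: xs)) a := by
  induction n with
  | zero => simp
  | succ n ih =>
    have h0 := h n (Nat.lt_succ_self n)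
    rw [List.replicate_succ, List.cons_append] at h0
    rw [List.replicate_succ, List.cons_append, Fword_zip_cons_self, h0,
      ih fun k hk => h k (hk.trans (Nat.lt_succ_self n))]
    ring

/-- On full instantiations of a section, `F` is a monomial up to a positive constant. -/
lemma exists_Fword_instWord {cs : List (Bool × ℕ∞)} (hcs : IsSection cs) (xs : List ℝ)
    (hx : ∀ x ∈ xs, 0 < x) (hlen : (infSigns cs).length ≤ xs.length) :
    ∃ C : ℝ, 0 < C ∧ ∀ n : ℕ → ℕ, (∀ j, 1 ≤ n j) →
      Fword ((infSigns cs).zip xs) (instWord cs n)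
        = C * ∏ j ∈ Finset.range (infSigns cs).length, xs.getD j 0 ^ n j := by
  induction hcs generalizing xs with
  | single s =>
    match xs, hx, hlen with
    | [], _, hlen => simp [infSigns_cons_top] at hlen
    | x :: xs, hx, _ =>
    refine ⟨x, hx x List.mem_cons_self, fun n _ => ?_⟩
    have h := Fword_replicate_append s [] x xs [] (n 0) (by simp [Fword_nil])
    have h1 : Fword [(s, x)] [] = x := by rw [Fword_cons_nil, Fword_nil, zero_add]
    simp only [List.zip_cons_cons, List.zip_nil_left, h1] at h
    simpa [infSigns, instWord, mul_comm] using h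
  | @adj s s' r hs hr ih =>
    match xs, hx, hlen with
    | [], _, hlen => simp [infSigns_cons_top] at hlen
    | [_], _, hlen => simp [infSigns_cons_top] at hlen
    | x :: x' :: xs, hx, hlen =>
    have hx0 : 0 < x := hx x (by simp)
    have hx1 : 0 < x' := hx x' (by simp)
    have hx' : ∀ y ∈ x' :: xs, 0 < y := fun y hy => hx y (List.mem_cons_of_mem _ hy)
    obtain ⟨C, hC, hF⟩ := ih (x' :: xs) hx' (by simpa [infSigns_cons_top] using hlen)
    refine ⟨(x + x') / x' * C, by positivity, fun n hn => ?_⟩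
    have hz := Fword_tail_instWord hr xs (by simp_all) (fun j => n (j + 1)) (fun j => hn _)
    have hz' := fun k => Fword_tail_instWord (.adj hs hr) (x' :: xs) hx'
      (fun j => if j = 0 then k + 1 else n j)
      (fun j => by split_ifs; exacts [by omega, hn j])
    specialize hF (fun j => n (j + 1)) (fun j => hn _)
    rw [infSigns_cons_top s] at *
    rw [List.length_cons, Finset.prod_range_succ']
    simp only [instWord_cons_top s, List.tail_cons, if_true, Nat.add_eq_zero_iff, one_ne_zero,
      and_false, if_false] at *
    rw [Fword_replicate_append _ _ _ _ _ _ fun k _ => hz' k]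
    rw [infSigns_cons_top s'] at *
    simp only [instWord_cons_top s', List.tail_cons] at *
    rw [replicate_append_eq_cons (hn _)] at *
    rw [Fword_zip_cons_self, hz, zero_add] at hF
    rw [Fword_zip_cons_ne hs.symm, Fword_zip_cons_self, hz, zero_add]
    simp only [List.getD_cons_succ, List.getD_cons_zero] at *
    field_simp
    linear_combination (x + x') * hF
  | @sep s b r hs hr ih =>
    match xs, hx, hlen with
    | [], _, hlen => simp [infSigns_cons_top] at hlen
    | x :: xs, hx, hlen =>
    have hx0 : 0 < x := hx x (by simp)
    have hx' : ∀ y ∈ xs, 0 < y := fun y hy => hx y (List.mem_cons_of_mem _ hy)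
    obtain ⟨C, hC, hF⟩ := ih xs hx'
      (by simpa [infSigns_cons_top, infSigns_cons_one] using hlen)
    refine ⟨x * C, by positivity, fun n hn => ?_⟩
    have hz' := fun k => Fword_tail_instWord (.sep hs hr) xs hx'
      (fun j => if j = 0 then k + 1 else n j)
      (fun j => by split_ifs; exacts [by omega, hn j])
    have hz : Fword ((infSigns ((s, ⊤) :: r)).zip xs)
        (b :: instWord ((s, ⊤) :: r) (fun j => n (j + 1))) = 0 := by
      cases xs with
      | nil => simp [Fword_nil]
      | cons y xs =>
        have hz := Fword_tail_instWord hr xs (by simp_all) (fun j => n (j + 1)) (fun j => hn _)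
        rw [infSigns_cons_top] at hz ⊢
        rw [List.tail_cons] at hz
        rw [Fword_zip_cons_ne hs.symm, Fword_cons_word_eq_zero (zip_pos (by simp_all) _) hz, hz]
        simp
    specialize hF (fun j => n (j + 1)) (fun j => hn _)
    rw [infSigns_cons_top s ((b, 1) :: (s, ⊤) :: r), infSigns_cons_one] at hz' ⊢
    rw [List.length_cons, Finset.prod_range_succ', instWord_cons_top s, instWord_cons_one]
    simp only [List.tail_cons, if_true, Nat.add_eq_zero_iff, one_ne_zero,
      and_false, if_false, instWord_cons_top s ((b, 1) :: _), instWord_cons_one] at hz'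
    rw [Fword_replicate_append _ _ _ _ _ _ fun k _ => hz' k]
    rw [Fword_zip_cons_ne hs.symm, hz, hF]
    simp only [List.getD_cons_succ, List.getD_cons_zero]
    ring

/-- The binary word with prescribed blocks. -/
def blockWord (rs : List (Bool × ℕ)) : BW := (rs.map fun r => List.replicate r.2 r.1).flatten

lemma blockWord_nil : blockWord [] = [] := rfl

lemma blockWord_cons (r : Bool × ℕ) (rs : List (Bool × ℕ)) :
    blockWord (r :: rs) = List.replicate r.2 r.1 ++ blockWord rs := rfl

lemma blockWord_append (rs qs : List (Bool × ℕ)) :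
    blockWord (rs ++ qs) = blockWord rs ++ blockWord qs := by
  simp [blockWord]

lemma sublist_of_cons_sublist_replicate_append {d c : Bool} (h : d ≠ c) {a b : BW} {n : ℕ}
    (hs : (d :: a).Sublist (List.replicate n c ++ b)) : (d :: a).Sublist b := by
  induction n with
  | zero => simpa using hs
  | succ n ih =>
    rw [List.replicate_succ, List.cons_append, List.cons_sublist_cons'] at hs
    exact ih (hs.resolve_right fun h' => h h'.1)

lemma blockWord_pos_cons {r : Bool × ℕ} (hr : 1 ≤ r.2) (rs : List (Bool × ℕ)) :
    blockWord (r :: rs) = r.1 :: (List.replicate (r.2 - 1) r.1 ++ blockWord rs) :=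
  replicate_append_eq_cons hr _ _

/-- An alternating word loses its first run in no embedding: it is not a subword of a word
whose signs are those of its remaining runs. -/
lemma not_blockWord_cons_sublist (rs : List (Bool × ℕ)) (r : Bool × ℕ) (bs : List (Bool × ℕ))
    (hpos : ∀ q ∈ r :: rs, 1 ≤ q.2) (hc : ((r :: rs).map Prod.fst).IsChain (· ≠ ·))
    (hb : bs.map Prod.fst = rs.map Prod.fst) :
    ¬ (blockWord (r :: rs)).Sublist (blockWord bs) := by
  induction rs generalizing r bs with
  | nil =>
    obtain rfl : bs = [] := by simpa using hb
    rw [blockWord_pos_cons (hpos r (by simp))]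
    simp [blockWord_nil]
  | cons q rs ih =>
    match bs, hb with
    | b :: bs, hb =>
      simp only [List.map_cons, List.cons.injEq, List.isChain_cons_cons] at hb hc
      intro hs
      rw [blockWord_cons b, blockWord_pos_cons (hpos r (by simp))] at hs
      have hs := sublist_of_cons_sublist_replicate_append (hb.1 ▸ hc.1) hs
      refine ih q bs (fun x hx => hpos x (List.mem_cons_of_mem _ hx)) hc.2 hb.2
        (List.Sublist.trans ?_ hs)
      exact (List.sublist_append_right _ _).trans (List.sublist_cons_self _ _)

/-- Subwords between words with the same alternating signs are compared blockwise. -/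
lemma forall₂_le_of_blockWord_sublist (rs bs : List (Bool × ℕ))
    (hpos : ∀ q ∈ rs, 1 ≤ q.2) (hc : (rs.map Prod.fst).IsChain (· ≠ ·))
    (hb : bs.map Prod.fst = rs.map Prod.fst)
    (hs : (blockWord rs).Sublist (blockWord bs)) :
    List.Forall₂ (fun r b => r.2 ≤ b.2) rs bs := by
  induction rs generalizing bs with
  | nil =>
    obtain rfl : bs = [] := by simpa using hb
    exact .nil
  | cons r rs ih =>
    match bs, hb with
    | b :: bs, hb =>
      simp only [List.map_cons, List.cons.injEq] at hb
      have hle : r.2 ≤ b.2 := by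
        by_contra! hlt
        have hr : blockWord (r :: rs)
            = List.replicate b.2 b.1 ++ blockWord ((r.1, r.2 - b.2) :: rs) := by
          rw [blockWord_cons, blockWord_cons, ← List.append_assoc, hb.1,
            ← List.replicate_add, Nat.add_sub_cancel' hlt.le]
        rw [hr, blockWord_cons b, List.append_sublist_append_left] at hs
        refine not_blockWord_cons_sublist rs (r.1, r.2 - b.2) bs ?_ hc hb.2 hs
        intro q hq
        rcases List.mem_cons.1 hq with rfl | hq
        · exact Nat.sub_pos_of_lt hlt
        · exact hpos q (List.mem_cons_of_mem _ hq)
      refine .cons hle (ih bs (fun x hx => hpos x (List.mem_cons_of_mem _ hx))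
        (by simpa using hc.tail) hb.2 ?_)
      have hb' : blockWord (b :: bs)
          = List.replicate r.2 r.1 ++ (List.replicate (b.2 - r.2) r.1 ++ blockWord bs) := by
        rw [blockWord_cons, ← List.append_assoc, ← hb.1,
          ← List.replicate_add, Nat.add_sub_cancel' hle]
      rw [hb', blockWord_cons, List.append_sublist_append_left] at hs
      match rs, hc with
      | [], _ => simp [blockWord_nil]
      | q :: rs, hc =>
        simp only [List.map_cons, List.isChain_cons_cons] at hc
        rw [blockWord_pos_cons (hpos q (by simp))] at hs ⊢
        exact sublist_of_cons_sublist_replicate_append hc.1.symm hs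

/-- `a` is obtained from the list of clusters `cs` by replacing every infinite multiplicity
by some positive one. -/
def IsInst (cs : List (Bool × ℕ∞)) (a : BW) : Prop :=
  ∃ rs : List (Bool × ℕ),
    List.Forall₂ (fun c r => r.1 = c.1 ∧ 1 ≤ r.2 ∧ (c.2 ≠ ⊤ → r.2 = c.2.toNat)) cs rs ∧
    a = blockWord rs

lemma IsInst.append {cs ds : List (Bool × ℕ∞)} {a b : BW} (ha : IsInst cs a)
    (hb : IsInst ds b) : IsInst (cs ++ ds) (a ++ b) := by
  obtain ⟨rs, hrs, rfl⟩ := ha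
  obtain ⟨qs, hqs, rfl⟩ := hb
  exact ⟨rs ++ qs, List.rel_append hrs hqs, (blockWord_append _ _).symm⟩

lemma IsInst.flatten_ofFn {k : ℕ} {cs : Fin k → List (Bool × ℕ∞)} {ℓ : Fin k → BW}
    (h : ∀ i, IsInst (cs i) (ℓ i)) :
    IsInst (List.ofFn cs).flatten (List.ofFn ℓ).flatten := by
  induction k with
  | zero => exact ⟨[], by simp, by simp [blockWord_nil]⟩
  | succ k ih =>
    simpa [List.ofFn_succ] using (h 0).append (ih fun i => h i.succ)

lemma isInst_instWord (cs : List (Bool × ℕ∞)) (hpos : ∀ c ∈ cs, c.2 ≠ 0) (n : ℕ → ℕ)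
    (hn : ∀ j, 1 ≤ n j) : IsInst cs (instWord cs n) := by
  induction cs generalizing n with
  | nil => exact ⟨[], .nil, rfl⟩
  | cons c cs ih =>
    have hpos' : ∀ c ∈ cs, c.2 ≠ 0 := fun x hx => hpos x (List.mem_cons_of_mem _ hx)
    unfold instWord
    split_ifs with hc
    · obtain ⟨rs, hrs, ha⟩ := ih hpos' (fun j => n (j + 1)) fun j => hn _
      exact ⟨(c.1, n 0) :: rs, .cons ⟨rfl, hn 0, fun h => absurd hc h⟩ hrs, by
        rw [ha, blockWord_cons]⟩
    · obtain ⟨rs, hrs, ha⟩ := ih hpos' n hn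
      refine ⟨(c.1, c.2.toNat) :: rs, .cons ⟨rfl, ?_, fun _ => rfl⟩ hrs, by
        rw [ha, blockWord_cons]⟩
      exact Nat.one_le_iff_ne_zero.2 fun h =>
        (ENat.toNat_eq_zero.1 h).elim (hpos c List.mem_cons_self) hc

lemma isInst_flangeWord (cs : List (Bool × ℕ∞)) (hpos : ∀ c ∈ cs, c.2 ≠ 0)
    (hfin : ∀ c ∈ cs, c.2 ≠ ⊤) : IsInst cs (flangeWord cs) := by
  have h : flangeWord cs = instWord cs 1 := by
    clear hpos
    induction cs with
    | nil => rfl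
    | cons c cs ih =>
      rw [instWord, if_neg (hfin c List.mem_cons_self),
        ← ih fun x hx => hfin x (List.mem_cons_of_mem _ hx)]
      simp [flangeWord]
  exact h ▸ isInst_instWord cs hpos 1 fun _ => le_rfl

/-- The blocks of `clWord cs N`. -/
def clBlocks (cs : List (Bool × ℕ∞)) (N : ℕ) : List (Bool × ℕ) :=
  cs.map fun c => (c.1, if c.2 = ⊤ then N else c.2.toNat)

lemma clWord_eq_blockWord (cs : List (Bool × ℕ∞)) (N : ℕ) :
    clWord cs N = blockWord (clBlocks cs N) := by
  simp [clWord, blockWord, clBlocks, Function.comp_def]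

lemma clBlocks_map_fst (cs : List (Bool × ℕ∞)) (N : ℕ) :
    (clBlocks cs N).map Prod.fst = cs.map Prod.fst := by
  simp [clBlocks, Function.comp_def]

lemma clWord_append (cs ds : List (Bool × ℕ∞)) (N : ℕ) :
    clWord (cs ++ ds) N = clWord cs N ++ clWord ds N := by
  simp [clWord]

lemma clWord_mono (cs : List (Bool × ℕ∞)) {M N : ℕ} (h : M ≤ N) :
    (clWord cs M).Sublist (clWord cs N) := by
  induction cs with
  | nil => exact List.Sublist.refl _
  | cons c cs ih =>
    simp only [clWord, List.map_cons, List.flatten_cons] at ih ⊢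
    refine List.Sublist.append (List.replicate_sublist_replicate _ |>.2 ?_) ih
    split_ifs
    exacts [h, le_rfl]

lemma append_mem_Zcl {cs ds : List (Bool × ℕ∞)} {a b : BW} (ha : a ∈ Zcl cs)
    (hb : b ∈ Zcl ds) : a ++ b ∈ Zcl (cs ++ ds) := by
  obtain ⟨M, hM⟩ := ha
  obtain ⟨N, hN⟩ := hb
  refine ⟨max M N, ?_⟩
  rw [clWord_append]
  exact (hM.trans (clWord_mono _ (le_max_left _ _))).append
    (hN.trans (clWord_mono _ (le_max_right _ _)))

lemma flatten_ofFn_mem_Zcl {k : ℕ} {cs : Fin k → List (Bool × ℕ∞)} {ℓ : Fin k → BW}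
    (h : ∀ i, ℓ i ∈ Zcl (cs i)) : (List.ofFn ℓ).flatten ∈ Zcl (List.ofFn cs).flatten := by
  induction k with
  | zero => exact ⟨0, by simp⟩
  | succ k ih =>
    simpa [List.ofFn_succ] using append_mem_Zcl (h 0) (ih fun i => h i.succ)

lemma IsInst.mem_Zcl {cs : List (Bool × ℕ∞)} {a : BW} (h : IsInst cs a) : a ∈ Zcl cs := by
  obtain ⟨rs, hrs, rfl⟩ := h
  induction hrs with
  | nil => exact ⟨0, by simp [blockWord_nil]⟩
  | @cons c r cs rs hc _ ih =>
    rw [blockWord_cons]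
    refine append_mem_Zcl (cs := [c]) ⟨r.2, ?_⟩ ih
    simp only [clWord, List.map_cons, List.map_nil, List.flatten_cons, List.flatten_nil,
      List.append_nil, hc.1]
    refine List.replicate_sublist_replicate _ |>.2 ?_
    split_ifs with h
    exacts [le_rfl, (hc.2.2 h).le]

section

variable {cs : List (Bool × ℕ∞)} {rs : List (Bool × ℕ)}

lemma map_fst_eq_of_forall₂
    (h : List.Forall₂ (fun (c : Bool × ℕ∞) (r : Bool × ℕ) =>
      r.1 = c.1 ∧ 1 ≤ r.2 ∧ (c.2 ≠ ⊤ → r.2 = c.2.toNat)) cs rs) :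
    rs.map Prod.fst = cs.map Prod.fst := by
  induction h with
  | nil => rfl
  | cons h _ ih => rw [List.map_cons, List.map_cons, ih, h.1]

lemma one_le_of_forall₂
    (h : List.Forall₂ (fun (c : Bool × ℕ∞) (r : Bool × ℕ) =>
      r.1 = c.1 ∧ 1 ≤ r.2 ∧ (c.2 ≠ ⊤ → r.2 = c.2.toNat)) cs rs) :
    ∀ r ∈ rs, 1 ≤ r.2 := by
  induction h with
  | nil => simp
  | cons h _ ih => exact List.forall_mem_cons.2 ⟨h.2.1, ih⟩

end

lemma eq_append_of_blockWord_eq_append {rs : List (Bool × ℕ)} (hpos : ∀ r ∈ rs, 1 ≤ r.2)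
    {p : BW} {b : Bool} (h : blockWord rs = p ++ [b]) : ∃ rs' m, rs = rs' ++ [(b, m)] := by
  rcases List.eq_nil_or_concat rs with rfl | ⟨rs', ⟨b', m⟩, rfl⟩
  · simp [blockWord_nil] at h
  · obtain ⟨m, rfl⟩ := Nat.exists_eq_add_of_le' (hpos (b', m) (by simp))
    rw [List.concat_eq_append, blockWord_append, blockWord_cons, blockWord_nil] at h
    simp only [List.append_nil] at h
    rw [List.replicate_succ', ← List.append_assoc] at h
    obtain ⟨-, h⟩ := List.append_inj' h rfl
    obtain rfl : b' = b := by simpa using h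
    exact ⟨rs', _, List.concat_eq_append ..⟩

lemma IsInst.append_unique {cs ds : List (Bool × ℕ∞)} {a b x y : BW}
    (hc : (cs ++ ds).IsChain fun c d => c.1 ≠ d.1) (ha : IsInst cs a) (hb : IsInst ds b)
    (hx : x ∈ Zcl cs) (hy : y ∈ Zcl ds) (h : x ++ y = a ++ b) : x = a ∧ y = b := by
  obtain ⟨rs, hrs, rfl⟩ := ha
  obtain ⟨qs, hqs, rfl⟩ := hb
  obtain ⟨M, hM⟩ := hx
  obtain ⟨N, hN⟩ := hy
  rw [clWord_eq_blockWord] at hM hN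
  have hrs1 := map_fst_eq_of_forall₂ hrs
  have hqs1 := map_fst_eq_of_forall₂ hqs
  have hrs2 := one_le_of_forall₂ hrs
  have hqs2 := one_le_of_forall₂ hqs
  have hc' : ((rs ++ qs).map Prod.fst).IsChain (· ≠ ·) := by
    rw [List.map_append, hrs1, hqs1, ← List.map_append, List.isChain_map]
    exact hc
  rcases List.append_eq_append_iff.1 h with ⟨z, hz, hz'⟩ | ⟨z, hz, hz'⟩
  · rcases List.eq_nil_or_concat z with rfl | ⟨z', e, rfl⟩
    · simpa using And.intro hz.symm hz'
    · exfalso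
      rw [List.concat_eq_append, ← List.append_assoc] at hz
      obtain ⟨rs', m, rfl⟩ := eq_append_of_blockWord_eq_append hrs2 hz
      refine not_blockWord_cons_sublist qs (e, 1) (clBlocks ds N) ?_ ?_ ?_
        (List.Sublist.trans ?_ hN)
      · exact List.forall_mem_cons.2 ⟨le_rfl, hqs2⟩
      · rw [List.append_assoc, List.map_append] at hc'
        exact hc'.right_of_append
      · rw [clBlocks_map_fst, hqs1]
      · rw [hz', List.concat_eq_append, List.append_assoc]
        exact List.sublist_append_right _ _
  · cases z with
    | nil => simpa using And.intro hz hz'.symm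
    | cons e z =>
      exfalso
      match qs, hqs2, hc', hz' with
      | (e', m) :: qs, hqs2, hc', hz' =>
        have hm : 1 ≤ m := hqs2 (e', m) (by simp)
        rw [blockWord_pos_cons hm, List.cons_append, List.cons.injEq] at hz'
        obtain rfl : e' = e := hz'.1
        have hle := forall₂_le_of_blockWord_sublist (rs ++ [(e', 1)])
          (clBlocks cs M ++ [(e', 0)]) ?_ ?_ ?_ ?_
        · have hlast := (List.forall₂_reverse_iff).2 hle
          simp at hlast
        · intro q hq
          rcases List.mem_append.1 hq with hq | hq
          · exact hrs2 q hq
          · simp_all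
        · have : (rs ++ (e', m) :: qs).map Prod.fst
              = (rs ++ [(e', 1)]).map Prod.fst ++ qs.map Prod.fst := by simp
          rw [this] at hc'
          exact hc'.left_of_append
        · simp [clBlocks_map_fst, hrs1]
        · rw [blockWord_append, blockWord_append]
          refine List.Sublist.trans ?_ (List.sublist_append_left _ _)
          refine List.Sublist.trans ?_ hM
          rw [hz]
          simp [blockWord]

lemma IsInst.flatten_unique {k : ℕ} {cs : Fin k → List (Bool × ℕ∞)} {ℓ ℓ' : Fin k → BW}
    (hc : (List.ofFn cs).flatten.IsChain fun c d => c.1 ≠ d.1)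
    (h : ∀ i, IsInst (cs i) (ℓ i)) (h' : ∀ i, ℓ' i ∈ Zcl (cs i))
    (heq : (List.ofFn ℓ').flatten = (List.ofFn ℓ).flatten) : ℓ' = ℓ := by
  induction k with
  | zero => exact Subsingleton.elim _ _
  | succ k ih =>
    simp only [List.ofFn_succ, List.flatten_cons] at hc heq
    obtain ⟨h0, h1⟩ := IsInst.append_unique hc (h 0) (IsInst.flatten_ofFn fun i => h i.succ)
      (h' 0) (flatten_ofFn_mem_Zcl fun i => h' i.succ) heq
    have h2 := ih hc.right_of_append (fun i => h i.succ) (fun i => h' i.succ) h1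
    funext i
    refine Fin.cases h0 (fun j => congrFun h2 j) i

lemma IsInst.notMem_Jt {t : Template} {a : BW} (h : IsInst t.clusters a) : a ∉ Jt t := by
  rintro ⟨p, ⟨hp, hfin, -⟩, N, hs⟩
  obtain ⟨rs, hrs, rfl⟩ := h
  have h1 := map_fst_eq_of_forall₂ hrs
  have h2 := one_le_of_forall₂ hrs
  rw [clWord_eq_blockWord] at hs
  have hle := forall₂_le_of_blockWord_sublist rs (clBlocks (decAt t.clusters p) N) h2
    (by rw [h1, List.isChain_map]; exact t.alternating)
    (by
      rw [clBlocks_map_fst, h1, decAt, List.map_set, List.getD_eq_getElem _ _ hp,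
        ← List.getElem_map Prod.fst (h := by simpa using hp), List.set_getElem_self]) hs
  rw [List.forall₂_iff_get] at hle hrs
  have hp' : p < rs.length := hrs.1 ▸ hp
  have hle := hle.2 p hp' (hle.1 ▸ hp')
  have hr := (hrs.2 p hp hp').2
  rw [List.getD_eq_getElem _ _ hp] at hfin
  have hpos := t.pos _ (List.getElem_mem hp)
  simp only [List.get_eq_getElem, clBlocks, decAt, List.getElem_map, List.getElem_set_self,
    List.getD_eq_getElem _ _ hp] at hle hr
  have hr2 := hr.2 hfin
  generalize (t.clusters[p]).2 = m at *
  lift m to ℕ using hfin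
  rw [if_neg (by exact_mod_cast ENat.natCast_ne_top (m - 1)), hr2] at hle
  have h3 : ((m : ℕ∞) - 1).toNat = m - 1 := by
    rw [← Nat.cast_one, ← ENat.natCast_sub, ENat.toNat_natCast]
  have h4 : m ≠ 0 := by exact_mod_cast hpos
  rw [h3, ENat.toNat_natCast] at hle
  omega

section

variable {t : Template} (D : SectionData t)

lemma mem_clusters_of_mem_A (j : Fin (D.k + 1)) {c : Bool × ℕ∞} (hc : c ∈ D.A j) :
    c ∈ t.clusters := by
  rw [D.concat]
  refine Fin.cases (motive := fun j => c ∈ D.A j → _) ?_ ?_ j hc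
  · intro hc
    exact List.mem_append_left _ hc
  · intro i hc
    refine List.mem_append_right _ (List.mem_flatten_of_mem ?_ (List.mem_append_right (D.T i).clusters hc))
    exact (List.mem_ofFn' _ _).2 ⟨i, rfl⟩

lemma isInst_flange (j : Fin (D.k + 1)) : IsInst (D.A j) (flangeWord (D.A j)) :=
  isInst_flangeWord _ (fun _ hc => t.pos _ (mem_clusters_of_mem_A D j hc)) (D.finA j)

lemma isInst_assemble {ℓ : Fin D.k → BW} (h : ∀ i, IsInst (D.T i).clusters (ℓ i)) :
    IsInst t.clusters (assemble D ℓ) := by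
  rw [D.concat]
  exact (isInst_flange D 0).append
    (IsInst.flatten_ofFn fun i => (h i).append (isInst_flange D i.succ))

lemma decompOf_unique {ℓ ℓ' : Fin D.k → BW} (h : ∀ i, IsInst (D.T i).clusters (ℓ i))
    (h' : decompOf D (assemble D ℓ) ℓ') : ℓ' = ℓ := by
  have heq := h'.2.symm
  rw [assemble, assemble, List.append_cancel_left_eq] at heq
  have hc := t.alternating
  rw [D.concat] at hc
  have := IsInst.flatten_unique (List.IsChain.right_of_append hc)
    (fun i => (h i).append (isInst_flange D i.succ))
    (fun i => append_mem_Zcl (h'.1 i) (isInst_flange D i.succ).mem_Zcl) heq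
  funext i
  exact List.append_cancel_right (congrFun this i)

lemma phiTW_assemble (w : List ℝ) {ℓ : Fin D.k → BW}
    (h : ∀ i, IsInst (D.T i).clusters (ℓ i)) :
    phiTW t D w (assemble D ℓ) = ENNReal.ofReal (∏ i, Fword (vD D w i) (ℓ i)) := by
  have hinst := isInst_assemble D h
  have hex : ∃ ℓ', decompOf D (assemble D ℓ) ℓ' := ⟨ℓ, fun i => (h i).mem_Zcl, rfl⟩
  have hZ : assemble D ℓ ∈ Zt t := hinst.mem_Zcl
  rw [phiTW, if_neg (not_not.2 hZ), if_neg hinst.notMem_Jt, dif_pos hex,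
    decompOf_unique D h hex.choose_spec]

lemma numInf_eq_sum : t.numInf = ∑ i, (infSigns (D.T i).clusters).length := by
  have hA : ∀ j, (D.A j).filter (fun c => decide (c.2 = ⊤)) = [] := fun j =>
    List.filter_eq_nil_iff.2 fun c hc => by simpa using D.finA j c hc
  rw [Template.numInf, D.concat, List.filter_append, hA, List.filter_flatten, List.map_ofFn,
    List.nil_append, List.length_flatten, List.map_ofFn, List.sum_ofFn]
  simp [infSigns, hA]

lemma secOffset_eq (i : Fin D.k) :
    secOffset D i
      = ∑ i' : Fin i, (infSigns (D.T (Fin.castLE i.2.le i')).clusters).length := by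
  refine (Finset.sum_bij (fun i' _ => Fin.castLE i.2.le i') ?_ ?_ ?_ ?_).symm
  · intro a _
    exact Finset.mem_filter.2 ⟨Finset.mem_univ _, a.2⟩
  · intro a _ b _ h
    exact Fin.castLE_injective _ h
  · intro b hb
    exact ⟨⟨b, by simpa using hb⟩, by simp, rfl⟩
  · intro a _
    rfl

/-- Every infinite cluster of `t` belongs to some section. -/
lemma exists_secOffset_add {g : ℕ} (hg : g < t.numInf) :
    ∃ i : Fin D.k, ∃ j < (infSigns (D.T i).clusters).length, g = secOffset D i + j := by
  rw [numInf_eq_sum D] at hg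
  obtain ⟨p, hp⟩ := finSigmaFinEquiv.surjective (⟨g, hg⟩ : Fin (∑ i, _))
  refine ⟨p.1, p.2, p.2.2, ?_⟩
  rw [secOffset_eq, ← finSigmaFinEquiv_apply, hp]

lemma secOffset_add_length_le (i : Fin D.k) :
    secOffset D i + (infSigns (D.T i).clusters).length ≤ t.numInf := by
  rw [numInf_eq_sum D, secOffset, add_comm,
    ← Finset.sum_insert (f := fun i => (infSigns (D.T i).clusters).length) (by simp)]
  exact Finset.sum_le_sum_of_subset (Finset.subset_univ _)

/-- Raising by one the multiplicity of the `j`-th infinite cluster of the section `i`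
multiplies `φ_{t,w}` by the weight of that cluster. -/
lemma exists_phiTW_ratio {w : List ℝ} (hlen : w.length = t.numInf) (hpos : ∀ x ∈ w, 0 < x)
    (i : Fin D.k) {j : ℕ} (hj : j < (infSigns (D.T i).clusters).length) :
    ∃ P : ℝ, 0 < P ∧
      phiTW t D w (assemble D fun i => instWord (D.T i).clusters 1) = ENNReal.ofReal P ∧
      phiTW t D w (assemble D fun i' => instWord (D.T i').clusters
        fun j' => if i' = i ∧ j' = j then 2 else 1)
        = ENNReal.ofReal (P * w.getD (secOffset D i + j) 0) := by
  have hpos' : ∀ i, ∀ x ∈ w.drop (secOffset D i), 0 < x :=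
    fun i x hx => hpos x (List.mem_of_mem_drop hx)
  have hle : ∀ i, (infSigns (D.T i).clusters).length ≤ (w.drop (secOffset D i)).length := by
    intro i
    have := secOffset_add_length_le D i
    rw [List.length_drop]
    omega
  choose C hC hF using fun i => exists_Fword_instWord (D.T i |>.isSection (D.secFin i))
    (w.drop (secOffset D i)) (hpos' i) (hle i)
  have hone : ∀ j, 1 ≤ (1 : ℕ → ℕ) j := fun _ => le_rfl
  have htwo : ∀ i' j', 1 ≤ if i' = i ∧ j' = j then 2 else 1 := by
    intro i' j'
    split_ifs <;> simp
  refine ⟨∏ i, Fword (vD D w i) (instWord (D.T i).clusters 1),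
    Finset.prod_pos fun i _ => ?_, phiTW_assemble D w fun i =>
      isInst_instWord _ (D.T i).pos _ hone, ?_⟩
  · rw [vD, hF i 1 hone]
    refine mul_pos (hC i) (Finset.prod_pos fun k hk => pow_pos ?_ _)
    have hk : k < (w.drop (secOffset D i)).length := (Finset.mem_range.1 hk).trans_le (hle i)
    rw [List.getD_eq_getElem _ _ hk]
    exact hpos' i _ (List.getElem_mem hk)
  · rw [phiTW_assemble D w fun i' => isInst_instWord _ (D.T i').pos _ (htwo i')]
    congr 1
    rw [← Finset.mul_prod_erase _ _ (Finset.mem_univ i), ← Finset.mul_prod_erase _ (fun i =>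
      Fword (vD D w i) (instWord (D.T i).clusters 1)) (Finset.mem_univ i), mul_right_comm]
    congr 1
    · rw [vD, hF i _ (htwo i), hF i _ hone, mul_assoc]
      congr 1
      rw [← Finset.mul_prod_erase _ _ (Finset.mem_range.2 hj), ← Finset.mul_prod_erase _
        (fun j => (w.drop (secOffset D i)).getD j 0 ^ (1 : ℕ → ℕ) j) (Finset.mem_range.2 hj)]
      have hw : (w.drop (secOffset D i)).getD j 0 = w.getD (secOffset D i + j) 0 := by
        simp [List.getD_eq_getElem?_getD, List.getElem?_drop]
      rw [hw, Finset.prod_congr rfl (g := fun j =>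
        (w.drop (secOffset D i)).getD j 0 ^ (1 : ℕ → ℕ) j)]
      · simp only [and_self, if_true, Pi.one_apply]
        ring
      · intro k hk
        simp [Finset.ne_of_mem_erase hk]
    · refine Finset.prod_congr rfl fun k hk => ?_
      simp only [Finset.ne_of_mem_erase hk, false_and, if_false]
      rfl

end

/-- part 3 of the Main Theorem.  For a fixed semifinite template `t`,
the map `w ↦ φ_{t,w}` is injective on tuples of positive weights summing to `1`. -/
theorem phiTW_injective
    (t : Template) (hsf : ¬t.IsFiniteTemplate) (D : SectionData t)
    (w w' : List ℝ)
    (hlen : w.length = t.numInf) (hwpos : ∀ x ∈ w, 0 < x) (hwsum : w.sum = 1)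
    (hlen' : w'.length = t.numInf) (hwpos' : ∀ x ∈ w', 0 < x) (hwsum' : w'.sum = 1)
    (heq : ∀ a ∈ Zt t, phiTW t D w a = phiTW t D w' a) :
    w = w' := by

  refine List.ext_getElem (hlen.trans hlen'.symm) fun g hg hg' => ?_
  obtain ⟨i, j, hj, rfl⟩ := exists_secOffset_add D (hlen ▸ hg)
  obtain ⟨P, hP, h1, h2⟩ := exists_phiTW_ratio D hlen hwpos i hj
  obtain ⟨P', hP', h1', h2'⟩ := exists_phiTW_ratio D hlen' hwpos' i hj
  have hmem : ∀ n : Fin D.k → ℕ → ℕ, (∀ i j, 1 ≤ n i j) →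
      assemble D (fun i => instWord (D.T i).clusters (n i)) ∈ Zt t := fun n hn =>
    (isInst_assemble D fun i => isInst_instWord _ (D.T i).pos _ (hn i)).mem_Zcl
  rw [List.getD_eq_getElem _ _ hg] at h2
  rw [List.getD_eq_getElem _ _ hg'] at h2'
  have hx := hwpos _ (List.getElem_mem hg)
  have hx' := hwpos' _ (List.getElem_mem hg')
  have e1 := heq _ (hmem (fun _ => 1) fun _ _ => le_rfl)
  have e2 := heq _ (hmem (fun i' j' => if i' = i ∧ j' = j then 2 else 1)
    fun _ _ => by split_ifs <;> simp)
  rw [h1, h1', ENNReal.ofReal_eq_ofReal_iff hP.le hP'.le] at e1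
  rw [h2, h2', ENNReal.ofReal_eq_ofReal_iff (mul_pos hP hx).le (mul_pos hP' hx').le, e1] at e2
  exact mul_left_cancel₀ hP'.ne' e2

end Zigzag
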